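/- The kernel (u,v) ↦ exp(-(e²/π)(λ coth λ - 1)) on the Lobachevsky space, where λ is the hyperbolic angle between u and v and e²/π > 0 is any positive constant, is continuous, invariant under Lorentz transformations, positive definite, and equals 1 on the diagonal. -/

import Mathlib

open scoped ComplexOrder

/-- Minkowski bilinear form on `ℝ⁴` with signature `(+,-,-,-)`. -/
def mink (u v : Fin 4 → ℝ) : ℝ :=
  u 0 * v 0 - u 1 * v 1 - u 2 * v 2 - u 3 * v 3

/-- The Lobachevsky space `𝓛₃`. -/
def Lob : Set (Fin 4 → ℝ) := {u | mink u u = 1 ∧ 0 < u 0}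

/-- Inverse hyperbolic cosine: `arcosh x = log (x + √(x² - 1))`. -/
noncomputable def arcosh (x : ℝ) : ℝ := Real.log (x + Real.sqrt (x ^ 2 - 1))

/-- `λ coth λ`, interpreted as `1` at `λ = 0`. -/
noncomputable def lcoth (l : ℝ) : ℝ :=
  if l = 0 then 1 else l * (Real.cosh l / Real.sinh l)

/-- The kernel `⟨u|v⟩ = exp (-z (λ coth λ - 1))`, `cosh λ = u·v`, `z = e²/π`. -/
noncomputable def kerZ (z : ℝ) (u v : Fin 4 → ℝ) : ℝ :=
  Real.exp (-z * (lcoth (arcosh (mink u v)) - 1))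

section

open MeasureTheory Set Filter Topology

/-- Stereographic parametrization of the future null cone, up to scaling. -/
def nullVec (ξ : ℝ × ℝ) : Fin 4 → ℝ :=
  ![1 + (ξ.1 ^ 2 + ξ.2 ^ 2), 2 * ξ.1, 2 * ξ.2, 1 - (ξ.1 ^ 2 + ξ.2 ^ 2)]

lemma mink_nullVec (w : Fin 4 → ℝ) (ξ : ℝ × ℝ) :
    mink w (nullVec ξ) = w 0 * (1 + (ξ.1 ^ 2 + ξ.2 ^ 2)) - w 1 * (2 * ξ.1) - w 2 * (2 * ξ.2)
      - w 3 * (1 - (ξ.1 ^ 2 + ξ.2 ^ 2)) := by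
  simp [mink, nullVec]

lemma mink_comm (u v : Fin 4 → ℝ) : mink u v = mink v u := by
  simp only [mink]; ring

lemma mink_smul_add (s : ℝ) (u v w : Fin 4 → ℝ) :
    mink (s • u + v) w = s * mink u w + mink v w := by
  simp only [mink, Pi.add_apply, Pi.smul_apply, smul_eq_mul]; ring

lemma zero_lt_add_of_mink_pos {w : Fin 4 → ℝ} (h0 : 0 < w 0) (hw : 0 < mink w w) :
    0 < w 0 + w 3 := by
  simp only [mink] at hw
  nlinarith [sq_nonneg (w 1), sq_nonneg (w 2)]

lemma mink_nullVec_eq {w : Fin 4 → ℝ} (hp : 0 < w 0 + w 3) (ξ : ℝ × ℝ) :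
    mink w (nullVec ξ) = (w 0 + w 3) * ((ξ.1 - w 1 / (w 0 + w 3)) ^ 2 +
      (ξ.2 - w 2 / (w 0 + w 3)) ^ 2) + mink w w / (w 0 + w 3) := by
  rw [mink_nullVec]
  simp only [mink]
  field_simp
  ring

lemma mink_nullVec_pos {w : Fin 4 → ℝ} (h0 : 0 < w 0) (hw : 0 < mink w w) (ξ : ℝ × ℝ) :
    0 < mink w (nullVec ξ) := by
  have hp := zero_lt_add_of_mink_pos h0 hw
  rw [mink_nullVec_eq hp]
  positivity

lemma mink_self_nonpos_of_orthogonal {w : Fin 4 → ℝ} {ξ : ℝ × ℝ} (h : mink w (nullVec ξ) = 0) :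
    mink w w ≤ 0 := by
  rw [mink_nullVec] at h
  simp only [mink]
  obtain ⟨a, b⟩ := ξ
  simp only at h
  set r := a ^ 2 + b ^ 2 with hr
  have hr0 : 0 ≤ r := by positivity
  have e : (1 + r) ^ 2 * (w 0 * w 0 - w 1 * w 1 - w 2 * w 2 - w 3 * w 3) =
      -((w 1 * (2 * b) - w 2 * (2 * a)) ^ 2 + (w 1 * (1 - r) - w 3 * (2 * a)) ^ 2 +
        (w 2 * (1 - r) - w 3 * (2 * b)) ^ 2) := by
    have h1 : w 0 * (1 + r) = w 1 * (2 * a) + w 2 * (2 * b) + w 3 * (1 - r) := by linarith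
    have h2 : (1 + r) ^ 2 = 4 * a ^ 2 + 4 * b ^ 2 + (1 - r) ^ 2 := by rw [hr]; ring
    have h3 : (w 0 * (1 + r)) ^ 2 = (w 1 * (2 * a) + w 2 * (2 * b) + w 3 * (1 - r)) ^ 2 := by
      rw [h1]
    linear_combination h3 - (w 1 * w 1 + w 2 * w 2 + w 3 * w 3) * h2
  have : 0 < (1 + r) ^ 2 := by positivity
  by_contra! hc
  have := mul_pos this hc
  rw [e] at this
  nlinarith [sq_nonneg (w 1 * (2 * b) - w 2 * (2 * a)), sq_nonneg (w 1 * (1 - r) - w 3 * (2 * a)),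
    sq_nonneg (w 2 * (1 - r) - w 3 * (2 * b))]

lemma lintegral_Ioi_of_hasDerivAt {g g' : ℝ → ℝ} {l : ℝ}
    (hderiv : ∀ x ∈ Ici (0 : ℝ), HasDerivAt g (g' x) x) (hpos : ∀ x ∈ Ioi (0 : ℝ), 0 ≤ g' x)
    (hg : Tendsto g atTop (𝓝 l)) :
    ∫⁻ x in Ioi (0 : ℝ), ENNReal.ofReal (g' x) = ENNReal.ofReal (l - g 0) := by
  rw [← integral_Ioi_of_hasDerivAt_of_nonneg' hderiv hpos hg,
    ofReal_integral_eq_lintegral_ofReal (integrableOn_Ioi_deriv_of_nonneg' hderiv hpos hg)]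
  exact (ae_restrict_iff' measurableSet_Ioi).2 (.of_forall hpos)

lemma lintegral_radial {p m : ℝ} (hp : 0 < p) (hm : 0 < m) :
    ∫⁻ ξ : ℝ × ℝ, ENNReal.ofReal (1 / (p * (ξ.1 ^ 2 + ξ.2 ^ 2) + m) ^ 2) =
      ENNReal.ofReal (Real.pi / (p * m)) := by
  rw [← lintegral_comp_polarCoord_symm]
  have h1 : ∀ q ∈ polarCoord.target, ENNReal.ofReal q.1 • ENNReal.ofReal
      (1 / (p * ((polarCoord.symm q).1 ^ 2 + (polarCoord.symm q).2 ^ 2) + m) ^ 2) =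
      ENNReal.ofReal (q.1 / (p * q.1 ^ 2 + m) ^ 2) := by
    intro q hq
    have hq0 : 0 < q.1 := hq.1
    rw [smul_eq_mul, ← ENNReal.ofReal_mul hq0.le, polarCoord_symm_apply]
    simp only [mul_pow, ← mul_add, Real.cos_sq_add_sin_sq, mul_one]
    rw [mul_one_div]
  rw [setLIntegral_congr_fun polarCoord.open_target.measurableSet h1, polarCoord_target,
    Measure.volume_eq_prod, ← Measure.prod_restrict, lintegral_prod _ (by fun_prop)]
  simp only [lintegral_const, Measure.restrict_apply MeasurableSet.univ, univ_inter,
    Real.volume_Ioo]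
  rw [lintegral_mul_const _ (by fun_prop)]
  have h2 : ∫⁻ r in Ioi (0 : ℝ), ENNReal.ofReal (r / (p * r ^ 2 + m) ^ 2) =
      ENNReal.ofReal (0 - (-(1 / (2 * p) * (p * 0 ^ 2 + m)⁻¹))) := by
    refine lintegral_Ioi_of_hasDerivAt (g := fun r => -(1 / (2 * p) * (p * r ^ 2 + m)⁻¹))
      (fun x _ => ?_) (fun x hx => ?_) ?_
    · have hx : p * x ^ 2 + m ≠ 0 := by positivity
      have := (((((hasDerivAt_id x).pow 2).const_mul p).add_const m).inv hx).const_mul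
        (1 / (2 * p))
      refine this.neg.congr_deriv ?_
      simp
      field_simp
    · have := hx.out
      positivity
    · have : Tendsto (fun r : ℝ => p * r ^ 2 + m) atTop atTop :=
        tendsto_atTop_add_const_right _ _ ((tendsto_pow_atTop two_ne_zero).const_mul_atTop hp)
      simpa using (this.inv_tendsto_atTop.const_mul (1 / (2 * p))).neg
  rw [h2, ← ENNReal.ofReal_mul (by simp; positivity)]
  congr 1
  field_simp
  ring

lemma lintegral_inv_mink_sq {w : Fin 4 → ℝ} (h0 : 0 < w 0) (hw : 0 < mink w w) :
    ∫⁻ ξ : ℝ × ℝ, ENNReal.ofReal (1 / mink w (nullVec ξ) ^ 2) =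
      ENNReal.ofReal (Real.pi / mink w w) := by
  have hp := zero_lt_add_of_mink_pos h0 hw
  have h := lintegral_radial hp (div_pos hw hp)
  rw [mul_div_cancel₀ _ hp.ne'] at h
  rw [← h, ← lintegral_sub_right_eq_self
    (fun ξ : ℝ × ℝ => ENNReal.ofReal (1 / ((w 0 + w 3) * (ξ.1 ^ 2 + ξ.2 ^ 2) +
      mink w w / (w 0 + w 3)) ^ 2)) (w 1 / (w 0 + w 3), w 2 / (w 0 + w 3))]
  simp only [mink_nullVec_eq hp, Prod.fst_sub, Prod.snd_sub]

lemma lintegral_Ioi_inv_sq {a b : ℝ} (ha : 0 < a) (hb : 0 < b) :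
    ∫⁻ s in Ioi (0 : ℝ), ENNReal.ofReal (1 / (s * a + b) ^ 2) = ENNReal.ofReal (1 / (a * b)) := by
  rw [lintegral_Ioi_of_hasDerivAt (g := fun s => -(1 / a * (s * a + b)⁻¹)) (l := 0)]
  · congr 1; field_simp; simp
  · intro x hx
    have hx0 : 0 ≤ x := hx
    have hx : x * a + b ≠ 0 := by positivity
    have := ((((hasDerivAt_id x).mul_const a).add_const b).inv hx).const_mul (1 / a)
    refine this.neg.congr_deriv ?_
    simp
    field_simp
  · intro x hx; positivity
  · have : Tendsto (fun r : ℝ => r * a + b) atTop atTop :=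
      tendsto_atTop_add_const_right _ _ (tendsto_id.atTop_mul_const ha)
    simpa using (this.inv_tendsto_atTop.const_mul (1 / a)).neg

lemma lcoth_eq (l : ℝ) : lcoth l = Real.cosh l / dslope Real.sinh 0 l := by
  unfold lcoth
  split_ifs with h
  · simp [h]
  · rw [dslope_of_ne _ h]
    simp [slope_def_field]
    have : Real.sinh l ≠ 0 := by simpa using h
    field_simp

lemma dslope_sinh_pos (l : ℝ) : 0 < dslope Real.sinh 0 l := by
  rcases eq_or_ne l 0 with rfl | h
  · simp
  · rw [dslope_of_ne _ h, slope_def_field]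
    simp only [Real.sinh_zero, sub_zero]
    rcases h.lt_or_gt with h | h
    · exact div_pos_of_neg_of_neg (by simpa using h) h
    · exact div_pos (by simpa using h) h

lemma continuous_lcoth : Continuous lcoth := by
  rw [funext lcoth_eq]
  refine Real.continuous_cosh.div ?_ fun l => (dslope_sinh_pos l).ne'
  rw [← continuousOn_univ, continuousOn_dslope univ_mem]
  exact ⟨Real.continuous_sinh.continuousOn, Real.differentiable_sinh.differentiableAt⟩

lemma lintegral_Ioi_inv_quadratic {l : ℝ} (hl : 0 ≤ l) :
    ∫⁻ s in Ioi (0 : ℝ), ENNReal.ofReal (1 / (s ^ 2 + 2 * s * Real.cosh l + 1)) =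
      ENNReal.ofReal (1 / dslope Real.sinh 0 l) := by
  have hq : ∀ s, s ^ 2 + 2 * s * Real.cosh l + 1 = (s + Real.exp l) * (s + Real.exp (-l)) := by
    intro s
    rw [Real.cosh_eq]
    have : Real.exp l * Real.exp (-l) = 1 := by rw [← Real.exp_add]; simp
    linear_combination -this
  rcases hl.eq_or_lt with rfl | hl
  · have := lintegral_Ioi_inv_sq one_pos one_pos
    simp only [mul_one] at this
    simp only [hq]
    simpa [← pow_two] using this
  have hs : 0 < Real.sinh l := by simpa using hl
  have e1 := Real.exp_pos l
  have e2 := Real.exp_pos (-l)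
  rw [lintegral_Ioi_of_hasDerivAt (l := 0) (g := fun s => 1 / (2 * Real.sinh l) *
      (Real.log (s + Real.exp (-l)) - Real.log (s + Real.exp l)))]
  · congr 1
    rw [dslope_of_ne _ hl.ne', slope_def_field]
    simp only [zero_add, Real.log_exp, Real.sinh_zero, sub_zero]
    field_simp
    ring
  · intro x hx
    have hx : 0 ≤ x := hx
    have h1 : x + Real.exp (-l) ≠ 0 := by positivity
    have h2 : x + Real.exp l ≠ 0 := by positivity
    have := ((((hasDerivAt_id x).add_const (Real.exp (-l))).log h1).sub
      (((hasDerivAt_id x).add_const (Real.exp l)).log h2)).const_mul (1 / (2 * Real.sinh l))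
    refine this.congr_deriv ?_
    rw [hq]
    simp only [id]
    have h3 : Real.exp l - Real.exp (-l) ≠ 0 := by
      rw [Real.sinh_eq] at hs; intro h; rw [h] at hs; simp at hs
    rw [Real.sinh_eq]
    field_simp
    ring
  · intro x hx
    have : 0 < x := hx
    rw [hq]; positivity
  · have h1 : Tendsto (fun s : ℝ => (Real.exp (-l) - Real.exp l) * (s + Real.exp l)⁻¹ + 1)
        atTop (𝓝 1) := by
      have := (tendsto_atTop_add_const_right atTop (Real.exp l) tendsto_id).inv_tendsto_atTop
      simpa using (this.const_mul (Real.exp (-l) - Real.exp l)).add_const 1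
    have h2 := ((Real.continuousAt_log one_ne_zero).tendsto.comp h1).const_mul
      (1 / (2 * Real.sinh l))
    simp only [Real.log_one, mul_zero] at h2
    refine h2.congr' ?_
    filter_upwards [eventually_gt_atTop 0] with s hs0
    have h3 : s + Real.exp (-l) ≠ 0 := by positivity
    have h4 : s + Real.exp l ≠ 0 := by positivity
    rw [← Real.log_div h3 h4]
    simp only [Function.comp]
    congr 2
    field_simp
    ring

lemma one_le_mink {u v : Fin 4 → ℝ} (hu : u ∈ Lob) (hv : v ∈ Lob) : 1 ≤ mink u v := by
  obtain ⟨hu1, hu0⟩ := hu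
  obtain ⟨hv1, hv0⟩ := hv
  simp only [mink] at *
  have h : (1 + (u 1 * v 1 + u 2 * v 2 + u 3 * v 3)) ^ 2 ≤ (u 0 * v 0) ^ 2 := by
    have h1 : (u 0 * v 0) ^ 2 = (1 + u 1 * u 1 + u 2 * u 2 + u 3 * u 3) *
        (1 + v 1 * v 1 + v 2 * v 2 + v 3 * v 3) := by
      rw [show 1 + u 1 * u 1 + u 2 * u 2 + u 3 * u 3 = u 0 * u 0 by linarith,
        show 1 + v 1 * v 1 + v 2 * v 2 + v 3 * v 3 = v 0 * v 0 by linarith]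
      ring
    rw [h1]
    nlinarith [sq_nonneg (u 1 - v 1), sq_nonneg (u 2 - v 2), sq_nonneg (u 3 - v 3),
      sq_nonneg (u 1 * v 2 - u 2 * v 1), sq_nonneg (u 1 * v 3 - u 3 * v 1),
      sq_nonneg (u 2 * v 3 - u 3 * v 2)]
  have := abs_le_of_sq_le_sq' h (by positivity)
  linarith [this.2]

lemma arcosh_nonneg {x : ℝ} (hx : 1 ≤ x) : 0 ≤ arcosh x := Real.arcosh_nonneg hx

lemma cosh_arcosh {x : ℝ} (hx : 1 ≤ x) : Real.cosh (arcosh x) = x := Real.cosh_arcosh hx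

lemma continuous_mink_nullVec (w : Fin 4 → ℝ) : Continuous fun ξ => mink w (nullVec ξ) := by
  simp only [mink_nullVec]; fun_prop

lemma Lob.mink_nullVec_pos {u : Fin 4 → ℝ} (hu : u ∈ Lob) (ξ : ℝ × ℝ) :
    0 < mink u (nullVec ξ) :=
  _root_.mink_nullVec_pos hu.2 (by rw [hu.1]; exact one_pos) ξ

lemma lintegral_inv_mink_mul_mink {u v : Fin 4 → ℝ} (hu : u ∈ Lob) (hv : v ∈ Lob) :
    ∫⁻ ξ : ℝ × ℝ, ENNReal.ofReal (1 / (mink u (nullVec ξ) * mink v (nullVec ξ))) =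
      ENNReal.ofReal (Real.pi / dslope Real.sinh 0 (arcosh (mink u v))) := by
  have hmeas : AEMeasurable (Function.uncurry fun (ξ : ℝ × ℝ) (s : ℝ) =>
      ENNReal.ofReal (1 / (s * mink u (nullVec ξ) + mink v (nullVec ξ)) ^ 2))
      ((volume : Measure (ℝ × ℝ)).prod (volume.restrict (Ioi 0))) := by
    have hu' := (continuous_mink_nullVec u).measurable
    have hv' := (continuous_mink_nullVec v).measurable
    refine Measurable.aemeasurable ?_
    simp only [Function.uncurry_def]
    refine ENNReal.measurable_ofReal.comp (measurable_const.div (Measurable.pow_const ?_ 2))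
    exact (measurable_snd.mul (hu'.comp measurable_fst)).add (hv'.comp measurable_fst)
  calc _ = ∫⁻ ξ : ℝ × ℝ, ∫⁻ s in Ioi (0 : ℝ),
        ENNReal.ofReal (1 / (s * mink u (nullVec ξ) + mink v (nullVec ξ)) ^ 2) :=
        lintegral_congr fun ξ =>
          (lintegral_Ioi_inv_sq (Lob.mink_nullVec_pos hu ξ) (Lob.mink_nullVec_pos hv ξ)).symm
    _ = ∫⁻ s in Ioi (0 : ℝ), ∫⁻ ξ : ℝ × ℝ,
        ENNReal.ofReal (1 / (s * mink u (nullVec ξ) + mink v (nullVec ξ)) ^ 2) :=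
        lintegral_lintegral_swap hmeas
    _ = ∫⁻ s in Ioi (0 : ℝ), ENNReal.ofReal Real.pi *
        ENNReal.ofReal (1 / (s ^ 2 + 2 * s * Real.cosh (arcosh (mink u v)) + 1)) := by
        refine setLIntegral_congr_fun measurableSet_Ioi fun s hs => ?_
        have hs0 : 0 < s := hs
        have hx := one_le_mink hu hv
        have hsq : mink (s • u + v) (s • u + v) = s ^ 2 + 2 * s * mink u v + 1 := by
          rw [mink_smul_add, mink_comm u, mink_comm v, mink_smul_add, mink_smul_add,
            mink_comm v u, hu.1, hv.1]
          ring
        have h0 : 0 < (s • u + v) 0 := by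
          have := hu.2
          have := hv.2
          simp only [Pi.add_apply, Pi.smul_apply, smul_eq_mul]
          positivity
        have := lintegral_inv_mink_sq h0 (by rw [hsq]; positivity)
        simp only [mink_smul_add s u v (nullVec _), hsq] at this
        simp only [this]
        rw [cosh_arcosh hx, ← ENNReal.ofReal_mul Real.pi_pos.le, mul_one_div]
    _ = _ := by
        rw [lintegral_const_mul _ (by fun_prop),
          lintegral_Ioi_inv_quadratic (arcosh_nonneg (one_le_mink hu hv)),
          ← ENNReal.ofReal_mul Real.pi_pos.le, mul_one_div]

lemma integrable_inv_mink_mul_mink {u v : Fin 4 → ℝ} (hu : u ∈ Lob) (hv : v ∈ Lob) :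
    Integrable fun ξ : ℝ × ℝ => 1 / (mink u (nullVec ξ) * mink v (nullVec ξ)) := by
  refine ⟨(Continuous.div continuous_const ((continuous_mink_nullVec u).mul
    (continuous_mink_nullVec v)) fun ξ => ?_).aestronglyMeasurable, ?_⟩
  · exact (mul_pos (Lob.mink_nullVec_pos hu ξ) (Lob.mink_nullVec_pos hv ξ)).ne'
  · rw [hasFiniteIntegral_iff_ofReal, lintegral_inv_mink_mul_mink hu hv]
    · exact ENNReal.ofReal_lt_top
    · refine .of_forall fun ξ => ?_
      have := mul_pos (Lob.mink_nullVec_pos hu ξ) (Lob.mink_nullVec_pos hv ξ)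
      simp only [Pi.zero_apply]
      positivity

lemma integral_mink_div {u v : Fin 4 → ℝ} (hu : u ∈ Lob) (hv : v ∈ Lob) :
    ∫ ξ : ℝ × ℝ, mink u v * (1 / (mink u (nullVec ξ) * mink v (nullVec ξ))) =
      Real.pi * lcoth (arcosh (mink u v)) := by
  have hd := dslope_sinh_pos (arcosh (mink u v))
  rw [integral_const_mul, integral_eq_lintegral_of_nonneg_ae _
    (integrable_inv_mink_mul_mink hu hv).aestronglyMeasurable, lintegral_inv_mink_mul_mink hu hv,
    ENNReal.toReal_ofReal (div_pos Real.pi_pos hd).le, lcoth_eq, cosh_arcosh (one_le_mink hu hv)]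
  · ring
  · refine .of_forall fun ξ => ?_
    have := mul_pos (Lob.mink_nullVec_pos hu ξ) (Lob.mink_nullVec_pos hv ξ)
    simp only [Pi.zero_apply]
    positivity

lemma mink_sum_left {ι : Type*} (s : Finset ι) (c : ι → ℝ) (f : ι → Fin 4 → ℝ) (w : Fin 4 → ℝ) :
    mink (∑ i ∈ s, c i • f i) w = ∑ i ∈ s, c i * mink (f i) w := by
  simp only [mink, Finset.sum_apply, Pi.smul_apply, smul_eq_mul, Finset.sum_mul, mul_sub,
    Finset.sum_sub_distrib, mul_assoc]

lemma mink_sum_right {ι : Type*} (s : Finset ι) (c : ι → ℝ) (f : ι → Fin 4 → ℝ) (w : Fin 4 → ℝ) :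
    mink w (∑ i ∈ s, c i • f i) = ∑ i ∈ s, c i * mink w (f i) := by
  rw [mink_comm, mink_sum_left]
  simp only [mink_comm w]

/-- `λ coth λ` is conditionally negative definite. -/
lemma sum_mul_lcoth_nonpos {ι : Type*} (s : Finset ι) (u : ι → Fin 4 → ℝ) (c : ι → ℝ)
    (hu : ∀ i, u i ∈ Lob) (hc : ∑ i ∈ s, c i = 0) :
    ∑ i ∈ s, ∑ j ∈ s, c i * c j * lcoth (arcosh (mink (u i) (u j))) ≤ 0 := by
  have hint : ∀ i j, Integrable fun ξ : ℝ × ℝ => c i * c j * (mink (u i) (u j) *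
      (1 / (mink (u i) (nullVec ξ) * mink (u j) (nullVec ξ)))) := fun i j =>
    ((integrable_inv_mink_mul_mink (hu i) (hu j)).const_mul _).const_mul _
  have h1 : Real.pi * ∑ i ∈ s, ∑ j ∈ s, c i * c j * lcoth (arcosh (mink (u i) (u j))) =
      ∫ ξ : ℝ × ℝ, ∑ i ∈ s, ∑ j ∈ s, c i * c j * (mink (u i) (u j) *
        (1 / (mink (u i) (nullVec ξ) * mink (u j) (nullVec ξ)))) := by
    rw [integral_finsetSum _ fun i _ => integrable_finsetSum _ fun j _ => hint i j,
      Finset.mul_sum]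
    refine Finset.sum_congr rfl fun i _ => ?_
    rw [integral_finsetSum _ fun j _ => hint i j, Finset.mul_sum]
    refine Finset.sum_congr rfl fun j _ => ?_
    rw [integral_const_mul, integral_mink_div (hu i) (hu j)]
    ring
  have h2 : Real.pi * ∑ i ∈ s, ∑ j ∈ s, c i * c j * lcoth (arcosh (mink (u i) (u j))) ≤ 0 := by
    rw [h1]
    refine integral_nonpos fun ξ => ?_
    set w := ∑ i ∈ s, (c i / mink (u i) (nullVec ξ)) • u i with hw
    have hk : mink w (nullVec ξ) = 0 := by
      rw [hw, mink_sum_left, ← hc]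
      exact Finset.sum_congr rfl fun i _ =>
        div_mul_cancel₀ _ (Lob.mink_nullVec_pos (hu i) ξ).ne'
    have hww : mink w w = ∑ i ∈ s, ∑ j ∈ s, c i * c j * (mink (u i) (u j) *
        (1 / (mink (u i) (nullVec ξ) * mink (u j) (nullVec ξ)))) := by
      conv_lhs => rw [hw, mink_sum_left]
      refine Finset.sum_congr rfl fun i _ => ?_
      rw [mink_sum_right, Finset.mul_sum]
      refine Finset.sum_congr rfl fun j _ => ?_
      field_simp
    simp only [Pi.zero_apply]
    rw [← hww]
    exact mink_self_nonpos_of_orthogonal hk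
  exact nonpos_of_mul_nonpos_right h2 Real.pi_pos

lemma posSemidef_iff_sum_sum {ι : Type*} [Fintype ι] {M : Matrix ι ι ℝ} :
    M.PosSemidef ↔ (∀ i j, M i j = M j i) ∧ ∀ x : ι → ℝ, 0 ≤ ∑ i, ∑ j, x i * x j * M i j := by
  rw [Matrix.posSemidef_iff_dotProduct_mulVec]
  refine and_congr ⟨fun h i j => ?_, fun h => ?_⟩ (forall_congr' fun x => ?_)
  · simpa using h.apply j i
  · ext i j
    simpa using h j i
  · simp only [dotProduct, Matrix.mulVec, Finset.mul_sum, star_trivial]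
    refine iff_of_eq (congrArg _ (Finset.sum_congr rfl fun i _ => Finset.sum_congr rfl
      fun j _ => ?_))
    ring

lemma Matrix.PosSemidef.map_pow {ι : Type*} [Fintype ι] {M : Matrix ι ι ℝ} (hM : M.PosSemidef)
    (k : ℕ) : (M.map (· ^ k)).PosSemidef := by
  induction k with
  | zero =>
    refine posSemidef_iff_sum_sum.2 ⟨by simp, fun x => ?_⟩
    simp only [Matrix.map_apply, pow_zero, mul_one, ← Finset.mul_sum, ← Finset.sum_mul]
    exact mul_self_nonneg _
  | succ k ih =>
    have : M.map (· ^ (k + 1)) = (M.map (· ^ k)).hadamard M := by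
      ext i j; simp [Matrix.hadamard, pow_succ]
    rw [this]
    exact ih.hadamard hM

lemma Matrix.PosSemidef.map_exp {ι : Type*} [Fintype ι] {M : Matrix ι ι ℝ} (hM : M.PosSemidef) :
    (M.map Real.exp).PosSemidef := by
  refine posSemidef_iff_sum_sum.2 ⟨fun i j => ?_, fun x => ?_⟩
  · simp [(posSemidef_iff_sum_sum.1 hM).1 i j]
  · have h : HasSum (fun k : ℕ => ∑ i, ∑ j, x i * x j * (M i j ^ k / (k.factorial : ℝ)))
        (∑ i, ∑ j, x i * x j * Real.exp (M i j)) := by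
      refine hasSum_sum fun i _ => hasSum_sum fun j _ => HasSum.mul_left _ ?_
      rw [Real.exp_eq_exp_ℝ]
      exact NormedSpace.expSeries_div_hasSum_exp (M i j)
    refine h.nonneg fun k => ?_
    have hk := (posSemidef_iff_sum_sum.1 (hM.map_pow k)).2 x
    have : ∑ i, ∑ j, x i * x j * (M i j ^ k / (k.factorial : ℝ)) =
        (∑ i, ∑ j, x i * x j * (M.map (· ^ k)) i j) / k.factorial := by
      simp only [Finset.sum_div, Matrix.map_apply, mul_div_assoc]
    rw [this]
    positivity

/-- **Schoenberg's theorem**: the exponential of minus a conditionally negative definite kernel is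
positive semidefinite. The index set is pointed in order to have a base point at hand. -/
lemma Matrix.PosSemidef.exp_neg_of_conditionally_negative {ι : Type*} [Fintype ι]
    (ψ : Option ι → Option ι → ℝ) (hsymm : ∀ i j, ψ i j = ψ j i)
    (hψ : ∀ c : Option ι → ℝ, ∑ i, c i = 0 → ∑ i, ∑ j, c i * c j * ψ i j ≤ 0) :
    (Matrix.of fun i j : ι => Real.exp (-ψ (some i) (some j))).PosSemidef := by
  have hK : (Matrix.of fun i j : ι => ψ (some i) none + ψ none (some j) - ψ (some i) (some j)
      - ψ none none).PosSemidef := by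
    refine posSemidef_iff_sum_sum.2 ⟨fun i j => ?_, fun c => ?_⟩
    · simp only [Matrix.of_apply]
      rw [hsymm (some i) none, hsymm none (some j), hsymm (some i)]
      ring
    · have h := hψ (fun o => o.elim (-∑ i, c i) c) (by simp [Fintype.sum_option])
      simp only [Fintype.sum_option, Option.elim] at h
      have e : ∑ i, ∑ j, c i * c j * (ψ (some i) none + ψ none (some j) - ψ (some i) (some j)
          - ψ none none) = (∑ i, c i * ψ (some i) none) * (∑ i, c i) +
          (∑ i, c i) * (∑ j, c j * ψ none (some j)) -
          (∑ i, ∑ j, c i * c j * ψ (some i) (some j)) - (∑ i, c i) * (∑ i, c i) * ψ none none := by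
        rw [Finset.sum_mul_sum, Finset.sum_mul_sum, Finset.sum_mul_sum]
        simp only [Finset.sum_mul, ← Finset.sum_add_distrib, ← Finset.sum_sub_distrib]
        exact Finset.sum_congr rfl fun i _ => Finset.sum_congr rfl fun j _ => by ring
      simp only [Matrix.of_apply]
      rw [e]
      have e1 : ∑ j, (-∑ i, c i) * c j * ψ none (some j) =
          -((∑ i, c i) * (∑ j, c j * ψ none (some j))) := by
        rw [← neg_mul, Finset.mul_sum]
        exact Finset.sum_congr rfl fun j _ => mul_assoc _ _ _
      have e2 : ∑ i, c i * (-∑ i, c i) * ψ (some i) none =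
          -((∑ i, c i * ψ (some i) none) * (∑ i, c i)) := by
        rw [← mul_neg, Finset.sum_mul]
        exact Finset.sum_congr rfl fun i _ => mul_right_comm _ _ _
      rw [Finset.sum_add_distrib, e1, e2] at h
      linarith
  refine posSemidef_iff_sum_sum.2 ⟨fun i j => ?_, fun c => ?_⟩
  · simp only [Matrix.of_apply]
    rw [hsymm]
  · have h := (posSemidef_iff_sum_sum.1 hK.map_exp).2 fun i => c i * Real.exp (-ψ (some i) none)
    have h' := mul_nonneg (Real.exp_pos (ψ none none)).le h
    refine h'.trans_eq ?_
    rw [Finset.mul_sum]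
    refine Finset.sum_congr rfl fun i _ => ?_
    rw [Finset.mul_sum]
    refine Finset.sum_congr rfl fun j _ => ?_
    have : Real.exp (-ψ (some i) (some j)) = Real.exp (ψ none none) * Real.exp (-ψ (some i) none) *
        Real.exp (-ψ (some j) none) * Real.exp (ψ (some i) none + ψ none (some j)
        - ψ (some i) (some j) - ψ none none) := by
      simp only [← Real.exp_add]
      rw [hsymm none (some j)]
      congr 1
      ring
    simp only [Matrix.of_apply, Matrix.map_apply]
    rw [this]
    ring

lemma Matrix.PosSemidef.sum_conj_mul_nonneg {ι : Type*} [Fintype ι] {M : Matrix ι ι ℝ}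
    (hM : M.PosSemidef) (α : ι → ℂ) :
    (0 : ℂ) ≤ ∑ i, ∑ j, (starRingEnd ℂ) (α i) * α j * (M i j : ℂ) := by
  obtain ⟨hsymm, hpos⟩ := posSemidef_iff_sum_sum.1 hM
  rw [Complex.nonneg_iff]
  constructor
  · have h := add_nonneg (hpos fun i => (α i).re) (hpos fun i => (α i).im)
    refine h.trans_eq ?_
    simp only [Complex.re_sum, ← Finset.sum_add_distrib]
    refine Finset.sum_congr rfl fun i _ => Finset.sum_congr rfl fun j _ => ?_
    simp
    ring
  · have e : ∀ i j, ((starRingEnd ℂ) (α i) * α j * (M i j : ℂ)).im =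
        (α i).re * (α j).im * M i j - (α j).re * (α i).im * M j i := by
      intro i j
      rw [hsymm j i]
      simp
      ring
    simp only [Complex.im_sum, e, Finset.sum_sub_distrib]
    rw [Finset.sum_comm (f := fun i j => (α j).re * (α i).im * M j i), sub_self]

lemma lcoth_arcosh_one : lcoth (arcosh 1) = 1 := by
  simp [arcosh, lcoth]

lemma posSemidef_kerZ {z : ℝ} (hz : 0 < z) {ι : Type*} [Fintype ι] (u : ι → Fin 4 → ℝ)
    (hu : ∀ i, u i ∈ Lob) : (Matrix.of fun i j => kerZ z (u i) (u j)).PosSemidef := by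
  have he : (![1, 0, 0, 0] : Fin 4 → ℝ) ∈ Lob := by simp [Lob, mink]
  set w : Option ι → Fin 4 → ℝ := fun o => o.elim ![1, 0, 0, 0] u with hw
  have hwL : ∀ o, w o ∈ Lob := by
    rintro (_ | i)
    exacts [he, hu i]
  have := Matrix.PosSemidef.exp_neg_of_conditionally_negative
    (fun i j => z * (lcoth (arcosh (mink (w i) (w j))) - 1))
    (fun i j => by simp only [mink_comm (w i)]) fun c hc => ?_
  · simpa only [kerZ, neg_mul, hw, Option.elim] using this
  · have h := sum_mul_lcoth_nonpos Finset.univ w c hwL hc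
    have e : ∑ i, ∑ j, c i * c j * (z * (lcoth (arcosh (mink (w i) (w j))) - 1)) =
        z * (∑ i, ∑ j, c i * c j * lcoth (arcosh (mink (w i) (w j))) -
          (∑ i, c i) * ∑ j, c j) := by
      rw [Finset.sum_mul_sum, ← Finset.sum_sub_distrib, Finset.mul_sum]
      refine Finset.sum_congr rfl fun i _ => ?_
      rw [← Finset.sum_sub_distrib, Finset.mul_sum]
      exact Finset.sum_congr rfl fun j _ => by ring
    rw [e, hc, mul_zero, sub_zero]
    exact mul_nonpos_of_nonneg_of_nonpos hz.le h

lemma continuousOn_kerZ (z : ℝ) :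
    ContinuousOn (fun q : (Fin 4 → ℝ) × (Fin 4 → ℝ) => kerZ z q.1 q.2) (Lob ×ˢ Lob) := by
  have hm : Continuous fun q : (Fin 4 → ℝ) × (Fin 4 → ℝ) => mink q.1 q.2 := by
    simp only [mink]; fun_prop
  have ha : ContinuousOn (fun q : (Fin 4 → ℝ) × (Fin 4 → ℝ) => arcosh (mink q.1 q.2))
      (Lob ×ˢ Lob) :=
    Real.continuousOn_arcosh.comp hm.continuousOn fun q hq => one_le_mink hq.1 hq.2
  exact Real.continuous_exp.comp_continuousOn
    (((continuous_lcoth.comp_continuousOn ha).sub continuousOn_const).const_mul (-z))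

end

/-- For any `z = e²/π > 0`, the kernel `exp(-z(λ coth λ - 1))` on the
Lobachevsky space is continuous, Lorentz invariant, positive definite, and
equals `1` on the diagonal. -/
theorem kerZ_properties (z : ℝ) (hz : 0 < z) :
    ContinuousOn (fun q : (Fin 4 → ℝ) × (Fin 4 → ℝ) => kerZ z q.1 q.2)
      (Lob ×ˢ Lob) ∧
    (∀ (Λ : (Fin 4 → ℝ) →ₗ[ℝ] (Fin 4 → ℝ)),
      (∀ x y, mink (Λ x) (Λ y) = mink x y) → (∀ u ∈ Lob, Λ u ∈ Lob) →
      ∀ u ∈ Lob, ∀ v ∈ Lob, kerZ z (Λ u) (Λ v) = kerZ z u v) ∧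
    (∀ (n : ℕ) (u : Fin n → (Fin 4 → ℝ)) (α : Fin n → ℂ),
      (∀ i, u i ∈ Lob) →
      (0 : ℂ) ≤ ∑ i, ∑ j, (starRingEnd ℂ) (α i) * α j * (kerZ z (u i) (u j) : ℂ)) ∧
    (∀ u ∈ Lob, kerZ z u u = 1) := by
  refine ⟨continuousOn_kerZ z, fun Λ hΛ _ u _ v _ => ?_, fun n u α hu => ?_, fun u hu => ?_⟩
  · simp only [kerZ, hΛ]
  · exact (posSemidef_kerZ hz u hu).sum_conj_mul_nonneg α
  · simp [kerZ, hu.1, lcoth_arcosh_one]
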